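/- arXiv:2402.13477 — 2 statements merged into one kernel-verified Lean document; each statement's English description precedes it below -/
import Mathlib

section
/- Let K be a field, 2 ≤ t ≤ n, S = K[x_1,…,x_n] with its standard grading, and write n = a t + b with a ≥ 1 and 0 ≤ b < t. Then for every s ≥ 1, the multiplicity of S/I_t(L_n)^s equals binomial(s + a − 1, s − 1) · binomial(a + t − b − 1, a); that is, the Hilbert function k ↦ dim_K (S/I_t(L_n)^s)_k agrees for all sufficiently large k with a polynomial in k of degree n − a − 1 whose leading coefficient is binomial(s + a − 1, s − 1) · binomial(a + t − b − 1, a)/(n − a − 1)!. In particular, the multiplicity of S/I_t(L_n)^s is a polynomial in s of degree a for all s ≥ 1. -/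
open MvPolynomial

/-- Generator of the path ideal: the product `x_{i+1} ⋯ x_{i+t}` of the variables with
0-based indices in `[i, i+t)`. -/
noncomputable def pathGen (K : Type*) [Field K] (n t i : ℕ) : MvPolynomial (Fin n) K :=
  ∏ j ∈ Finset.univ.filter (fun j : Fin n => i ≤ (j : ℕ) ∧ (j : ℕ) < i + t), X j

/-- The `t`-path ideal `I_t(L_n)` of the line graph `L_n`. -/
noncomputable def pathIdeal (K : Type*) [Field K] (n t : ℕ) : Ideal (MvPolynomial (Fin n) K) :=
  Ideal.span ((pathGen K n t) '' {i : ℕ | i + t ≤ n})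

/-- The Hilbert function of the graded quotient `S/I`: the `K`-dimension of the image of the
space of homogeneous polynomials of degree `k` in `S/I`. -/
noncomputable def hilbertFn (K : Type*) [Field K] (n : ℕ)
    (I : Ideal (MvPolynomial (Fin n) K)) (k : ℕ) : ℕ :=
  Module.finrank K
    ((homogeneousSubmodule (Fin n) K k).map (Ideal.Quotient.mkₐ K I).toLinearMap)

/-- The exponent vector `c` dominates a product of `s` generators of the `t`-path ideal. -/
def DominatesPathPow (n t s : ℕ) (c : Fin n → ℕ) : Prop :=
  ∃ m : Multiset ℕ, m.card = s ∧ (∀ i ∈ m, i + t ≤ n) ∧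
    ∀ j : Fin n, m.countP (fun i ↦ i ≤ (j : ℕ) ∧ (j : ℕ) < i + t) ≤ c j

/-- The exponent vector of a product of generators of the `t`-path ideal. -/
noncomputable def pathExponent (n t : ℕ) (m : Multiset ℕ) : Fin n →₀ ℕ :=
  Finsupp.equivFunOnFinite.symm fun j ↦ m.countP (fun i ↦ i ≤ (j : ℕ) ∧ (j : ℕ) < i + t)

lemma pathExponent_apply (n t : ℕ) (m : Multiset ℕ) (j : Fin n) :
    pathExponent n t m j = m.countP (fun i ↦ i ≤ (j : ℕ) ∧ (j : ℕ) < i + t) := rfl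

lemma pathExponent_add (n t : ℕ) (m m' : Multiset ℕ) :
    pathExponent n t (m + m') = pathExponent n t m + pathExponent n t m' := by
  ext j
  simp [pathExponent_apply]

lemma pathGen_eq_monomial (K : Type*) [Field K] (n t i : ℕ) :
    pathGen K n t i = monomial (pathExponent n t {i}) 1 := by
  have h : pathExponent n t {i} = ∑ j ∈ Finset.univ.filter
      (fun j : Fin n ↦ i ≤ (j : ℕ) ∧ (j : ℕ) < i + t), Finsupp.single j 1 := by
    ext j
    simp [pathExponent_apply, Finsupp.finsetSum_apply, Finsupp.single_apply,
      Multiset.countP_eq_card_filter, Multiset.filter_singleton, apply_ite Multiset.card]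
  rw [h, monomial_sum_one]
  rfl

lemma pathIdeal_pow_eq_span (K : Type*) [Field K] (n t s : ℕ) :
    pathIdeal K n t ^ s = Ideal.span ((fun e ↦ monomial e (1 : K)) ''
      (pathExponent n t '' {m | m.card = s ∧ ∀ i ∈ m, i + t ≤ n})) := by
  induction s with
  | zero =>
    have h : pathExponent n t 0 = 0 := by ext; simp [pathExponent_apply]
    rw [pow_zero, Ideal.one_eq_top, eq_comm, Ideal.eq_top_iff_one]
    refine Ideal.subset_span ⟨0, ⟨0, by simp, h⟩, rfl⟩
  | succ s ih =>
    rw [pow_succ, ih, pathIdeal, Ideal.span_mul_span']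
    congr 1
    ext f
    simp only [Set.mem_mul, Set.mem_image, Set.mem_ofPred_eq]
    constructor
    · rintro ⟨_, ⟨_, ⟨m, ⟨hm, hm'⟩, rfl⟩, rfl⟩, _, ⟨i, hi, rfl⟩, rfl⟩
      refine ⟨_, ⟨m + {i}, ⟨by simp [hm], ?_⟩, rfl⟩, ?_⟩
      · intro j hj
        rw [Multiset.mem_add, Multiset.mem_singleton] at hj
        rcases hj with hj | rfl
        exacts [hm' j hj, hi]
      · rw [pathExponent_add, pathGen_eq_monomial, monomial_mul, one_mul]
    · rintro ⟨_, ⟨m, ⟨hm, hm'⟩, rfl⟩, rfl⟩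
      obtain ⟨i, hi⟩ := Multiset.card_pos_iff_exists_mem.mp (by omega : 0 < m.card)
      obtain ⟨m, rfl⟩ := Multiset.exists_cons_of_mem hi
      refine ⟨_, ⟨_, ⟨m, ⟨by simpa using hm, fun j hj ↦ hm' j (Multiset.mem_cons_of_mem hj)⟩, rfl⟩,
        rfl⟩, _, ⟨i, hm' i hi, rfl⟩, ?_⟩
      rw [pathGen_eq_monomial, monomial_mul, one_mul, ← pathExponent_add, add_comm,
        Multiset.singleton_add]

lemma mem_pathIdeal_pow (K : Type*) [Field K] (n t s : ℕ) (f : MvPolynomial (Fin n) K) :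
    f ∈ pathIdeal K n t ^ s ↔ ∀ d ∈ f.support, DominatesPathPow n t s d := by
  rw [pathIdeal_pow_eq_span, mem_ideal_span_monomial_image]
  refine forall₂_congr fun d _ ↦ ?_
  simp only [Set.exists_mem_image, Set.mem_ofPred_eq, DominatesPathPow, Finsupp.le_def, and_assoc,
    pathExponent_apply]

open Classical in
/-- The Hilbert function of the quotient by a monomial ideal counts the standard monomials. -/
lemma hilbertFn_eq_card (K : Type*) [Field K] (n : ℕ) (I : Ideal (MvPolynomial (Fin n) K))
    (M : (Fin n → ℕ) → Prop) (hI : ∀ f, f ∈ I ↔ ∀ d ∈ f.support, M d) (k : ℕ) :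
    hilbertFn K n I k =
      ((Finset.finsuppAntidiag Finset.univ k).filter fun d : Fin n →₀ ℕ ↦ ¬ M d).card := by
  set B := (Finset.finsuppAntidiag (Finset.univ : Finset (Fin n)) k).filter
    fun d : Fin n →₀ ℕ ↦ ¬ M d with hB
  let φ := (Ideal.Quotient.mkₐ K I).toLinearMap
  let v : B → MvPolynomial (Fin n) K ⧸ I := fun d ↦ φ (monomial d.1 1)
  have hmem (d : Fin n →₀ ℕ) : d ∈ B ↔ d.degree = k ∧ ¬ M d := by
    simp [hB, Finsupp.degree_eq_sum]
  have hspan : (homogeneousSubmodule (Fin n) K k).map φ = Submodule.span K (Set.range v) := by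
    apply le_antisymm
    · rintro _ ⟨f, hf, rfl⟩
      rw [f.as_sum, map_sum]
      refine Submodule.sum_mem _ fun d hd ↦ ?_
      rw [← mul_one (coeff d f), ← smul_eq_mul, ← smul_monomial, map_smul]
      refine Submodule.smul_mem _ _ ?_
      have hdk : d.degree = k := by
        rw [Finsupp.degree_eq_weight_one]
        exact hf (mem_support_iff.mp hd)
      by_cases hM : M d
      · have : φ (monomial d 1) = 0 := by
          refine Ideal.Quotient.eq_zero_iff_mem.mpr ((hI _).mpr fun e he ↦ ?_)
          rw [Finset.mem_singleton.mp (support_monomial_subset he)]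
          exact hM
        rw [this]
        exact Submodule.zero_mem _
      · exact Submodule.subset_span ⟨⟨d, (hmem d).mpr ⟨hdk, hM⟩⟩, rfl⟩
    · rw [Submodule.span_le]
      rintro _ ⟨d, rfl⟩
      refine ⟨_, ?_, rfl⟩
      exact isHomogeneous_monomial _ ((hmem _).mp d.2).1
  have hli : LinearIndependent K v := by
    rw [Fintype.linearIndependent_iff]
    intro g hg d
    have hf : ∑ e, g e • monomial e.1 (1 : K) ∈ I := by
      rw [← Ideal.Quotient.eq_zero_iff_mem, ← hg]
      change φ _ = _
      simp only [map_sum, map_smul]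
      rfl
    by_contra hne
    refine ((hmem _).mp d.2).2 ((hI _).mp hf d.1 (mem_support_iff.mpr ?_))
    simpa [coeff_sum, coeff_monomial, -Finset.univ_eq_attach, Subtype.val_inj] using hne
  rw [hilbertFn]
  change Module.finrank K ((homogeneousSubmodule (Fin n) K k).map φ) = _
  rw [hspan, finrank_span_eq_card hli, Fintype.card_coe]

/-- The exponent vectors of degree `k` whose truncation at `s` is `c` correspond to exponent
vectors of degree `k - |c|` supported where `c` takes the value `s`. -/
lemma card_filter_min_eq {ι : Type*} [Fintype ι] [DecidableEq ι] (s k : ℕ) (c : ι → ℕ)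
    (hc : ∀ i, c i ≤ s) (hk : ∑ i, c i < k) :
    ((Finset.finsuppAntidiag Finset.univ k).filter
      fun d : ι →₀ ℕ ↦ (fun i ↦ min (d i) s) = c).card =
    ((Finset.univ.filter fun i ↦ c i = s).card + (k - ∑ i, c i) - 1).choose (k - ∑ i, c i) := by
  rw [← Finset.card_finsuppAntidiag_nat_eq_choose]
  let e : ι →₀ ℕ := Finsupp.equivFunOnFinite.symm c
  have he (i : ι) : e i = c i := rfl
  refine Finset.card_bij' (fun d _ ↦ d - e) (fun d _ ↦ d + e) ?_ ?_ ?_ ?_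
  · intro d hd
    simp only [Finset.mem_filter, Finset.mem_finsuppAntidiag] at hd ⊢
    obtain ⟨⟨hd, -⟩, h⟩ := hd
    have hle (i : ι) : c i ≤ d i := by rw [← h]; exact min_le_left _ _
    have h0 (i : ι) (hi : c i ≠ s) : d i - c i = 0 := by
      have := congrFun h i
      omega
    refine ⟨?_, ?_⟩
    · rw [Finset.sum_subset (Finset.subset_univ _)]
      · simp only [Finsupp.coe_tsub, Pi.sub_apply, he]
        rw [Finset.sum_tsub_distrib _ fun i _ ↦ hle i, hd]
      · intro i _ hi
        exact h0 i (by simpa using hi)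
    · intro i hi
      by_contra hi'
      exact Finsupp.mem_support_iff.mp hi (h0 i (by simpa using hi'))
  · intro d hd
    simp only [Finset.mem_filter, Finset.mem_finsuppAntidiag, Finset.subset_univ, and_true] at hd ⊢
    obtain ⟨hd, hsupp⟩ := hd
    have h0 (i : ι) (hi : c i ≠ s) : d i = 0 := by
      by_contra h
      simpa [hi] using hsupp (Finsupp.mem_support_iff.mpr h)
    refine ⟨?_, ?_⟩
    · simp only [Finsupp.coe_add, Pi.add_apply, he, Finset.sum_add_distrib]
      rw [Finset.sum_subset (Finset.subset_univ _)] at hd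
      · omega
      · intro i _ hi
        exact h0 i (by simpa using hi)
    · funext i
      have := hc i
      have := h0 i
      simp only [Finsupp.coe_add, Pi.add_apply, he]
      omega
  · intro d hd
    simp only [Finset.mem_filter] at hd
    ext i
    have := congrFun hd.2 i
    simp only [Finsupp.coe_add, Finsupp.coe_tsub, Pi.add_apply, Pi.sub_apply, he]
    omega
  · intro d _
    exact add_tsub_cancel_right d e

open Classical in
/-- If membership in a set of exponent vectors only depends on the truncation at `s`, the number of
its elements of degree `k` is eventually polynomial in `k`, and the leading coefficient counts
truncated vectors with the largest number of entries equal to `s`. -/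
lemma exists_polynomial_card_filter {ι : Type*} [Fintype ι] [DecidableEq ι]
    (A : (ι → ℕ) → Prop) (s D M : ℕ)
    (hA : ∀ d, A d ↔ A fun i ↦ min (d i) s)
    (hD : ∀ c, A c → (Finset.univ.filter fun i ↦ c i = s).card ≤ D + 1)
    (hM : ((Fintype.piFinset fun _ : ι ↦ Finset.range (s + 1)).filter
      fun c ↦ A c ∧ (Finset.univ.filter fun i ↦ c i = s).card = D + 1).card = M) (hM0 : M ≠ 0) :
    ∃ P : Polynomial ℚ, P.degree = D ∧ P.leadingCoeff = (M : ℚ) / D.factorial ∧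
      ∃ N : ℕ, ∀ k ≥ N, (((Finset.finsuppAntidiag Finset.univ k).filter
        fun d : ι →₀ ℕ ↦ A d).card : ℚ) = P.eval (k : ℚ) := by
  set B := (Fintype.piFinset fun _ : ι ↦ Finset.range (s + 1)).filter A with hB
  let z (c : ι → ℕ) : ℕ := (Finset.univ.filter fun i ↦ c i = s).card
  let Q (c : ι → ℕ) : Polynomial ℚ :=
    if z c = 0 then 0 else Polynomial.preHilbertPoly ℚ (z c - 1) (∑ i, c i)
  have hBmem (c : ι → ℕ) : c ∈ B ↔ (∀ i, c i ≤ s) ∧ A c := by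
    simp [hB, Fintype.mem_piFinset]
  have hcoeff : (∑ c ∈ B, Q c).coeff D = (M : ℚ) / D.factorial := by
    have h (c : ι → ℕ) (hc : c ∈ B) :
        (Q c).coeff D = if z c = D + 1 then (D.factorial : ℚ)⁻¹ else 0 := by
      have hz : z c ≤ D + 1 := hD c ((hBmem c).mp hc).2
      by_cases h0 : z c = 0
      · simp [Q, h0]
      by_cases h1 : z c = D + 1
      · simp [Q, h1, Polynomial.coeff_preHilbertPoly_self]
      · simp only [Q, h0, h1, if_false]
        apply Polynomial.coeff_eq_zero_of_natDegree_lt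
        rw [Polynomial.natDegree_preHilbertPoly]
        omega
    rw [Polynomial.finsetSum_coeff, Finset.sum_congr rfl h, ← Finset.sum_filter, Finset.sum_const,
      hB, Finset.filter_filter, hM, nsmul_eq_mul, div_eq_mul_inv]
  have hdeg : (∑ c ∈ B, Q c).natDegree ≤ D := by
    refine Polynomial.natDegree_sum_le_of_forall_le _ _ fun c hc ↦ ?_
    have hz : z c ≤ D + 1 := hD c ((hBmem c).mp hc).2
    by_cases h0 : z c = 0
    · simp [Q, h0]
    · simp only [Q, h0, if_false, Polynomial.natDegree_preHilbertPoly]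
      omega
  have hne : (∑ c ∈ B, Q c).coeff D ≠ 0 := by
    rw [hcoeff]
    have := D.factorial_ne_zero
    positivity
  have hnat : (∑ c ∈ B, Q c).natDegree = D :=
    le_antisymm hdeg (Polynomial.le_natDegree_of_ne_zero hne)
  refine ⟨∑ c ∈ B, Q c, ?_, ?_, Fintype.card ι * s + 1, fun k hk ↦ ?_⟩
  · rw [Polynomial.degree_eq_natDegree (fun h ↦ hne (by simp [h])), hnat]
  · rw [Polynomial.leadingCoeff, hnat, hcoeff]
  · rw [Finset.card_eq_sum_card_fiberwise (f := fun d i ↦ min (d i) s) (t := B), Nat.cast_sum,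
      Polynomial.eval_finsetSum]
    · refine Finset.sum_congr rfl fun c hc ↦ ?_
      obtain ⟨hcs, hAc⟩ := (hBmem c).mp hc
      have hsum : ∑ i, c i < k := by
        have := Finset.sum_le_card_nsmul Finset.univ c s fun i _ ↦ hcs i
        rw [Finset.card_univ, smul_eq_mul] at this
        exact lt_of_le_of_lt this hk
      have hfil : ((Finset.finsuppAntidiag Finset.univ k).filter fun d : ι →₀ ℕ ↦ A d).filter
          (fun d ↦ (fun i ↦ min (d i) s) = c) = (Finset.finsuppAntidiag Finset.univ k).filter
          fun d : ι →₀ ℕ ↦ (fun i ↦ min (d i) s) = c := by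
        rw [Finset.filter_filter]
        refine Finset.filter_congr fun d _ ↦ ⟨And.right, fun h ↦ ⟨?_, h⟩⟩
        rw [hA, h]
        exact hAc
      rw [hfil, card_filter_min_eq s k c hcs hsum]
      change ((z c + (k - ∑ i, c i) - 1).choose (k - ∑ i, c i) : ℚ) = _
      by_cases h0 : z c = 0
      · simp only [Q, h0, if_true, Polynomial.eval_zero]
        rw [Nat.choose_eq_zero_of_lt (by omega), Nat.cast_zero]
      · simp only [Q, h0, if_false]
        rw [Polynomial.preHilbertPoly_eq_choose_sub_add _ _ hsum.le,
          Nat.choose_symm_of_eq_add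
            (by omega : z c + (k - ∑ i, c i) - 1 = (k - ∑ i, c i) + (z c - 1))]
        congr 2
        omega
    · intro d hd
      rw [Finset.mem_coe, Finset.mem_filter] at hd
      exact (hBmem _).mpr ⟨fun i ↦ min_le_right _ _, (hA _).mp hd.2⟩

open Classical in
/-- The vertex covers with `a` elements of the hypergraph whose edges are the length `t` intervals
in `Fin n`. -/
noncomputable def pathCovers (n t a : ℕ) : Finset (Finset (Fin n)) :=
  (Finset.powersetCard a Finset.univ).filter fun C ↦
    ∀ i, i + t ≤ n → ∃ j ∈ C, i ≤ (j : ℕ) ∧ (j : ℕ) < i + t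

lemma mem_pathCovers {n t a : ℕ} {C : Finset (Fin n)} : C ∈ pathCovers n t a ↔
    C.card = a ∧ ∀ i, i + t ≤ n → ∃ j ∈ C, i ≤ (j : ℕ) ∧ (j : ℕ) < i + t := by
  simp only [pathCovers, Finset.mem_filter, Finset.mem_powersetCard_univ]

/-- The `j`-th element of a cover lies in the `j`-th block of length `t`, at a position that
weakly decreases with `j`. -/
lemma strictMono_cover_bounds {n t a : ℕ} (han : a * t ≤ n) {f : Fin a → Fin n}
    (hf : StrictMono f)
    (hcov : ∀ i, i + t ≤ n → ∃ j, i ≤ (f j : ℕ) ∧ (f j : ℕ) < i + t) :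
    ∀ (j : ℕ) (hj : j < a), (f ⟨j, hj⟩ : ℕ) < (j + 1) * t ∧
      ∀ hj' : j + 1 < a, (f ⟨j + 1, hj'⟩ : ℕ) ≤ f ⟨j, hj⟩ + t := by
  have step (j : ℕ) (hj : j < a) (h : (f ⟨j, hj⟩ : ℕ) < (j + 1) * t) (hj' : j + 1 < a) :
      (f ⟨j + 1, hj'⟩ : ℕ) ≤ f ⟨j, hj⟩ + t := by
    have h2 : (j + 2) * t ≤ a * t := Nat.mul_le_mul_right t hj'
    obtain ⟨k, hk, hk'⟩ := hcov (f ⟨j, hj⟩ + 1) (by nlinarith)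
    have hlt : (⟨j, hj⟩ : Fin a) < k := hf.lt_iff_lt.mp (by rw [Fin.lt_def]; omega)
    have hle : (⟨j + 1, hj'⟩ : Fin a) ≤ k := by
      rw [Fin.lt_def] at hlt
      rw [Fin.le_def]
      exact hlt
    have := hf.monotone hle
    rw [Fin.le_def] at this
    omega
  intro j
  induction j with
  | zero =>
    intro hj
    have h : (f ⟨0, hj⟩ : ℕ) < (0 + 1) * t := by
      obtain ⟨k, -, hk⟩ := hcov 0 (by nlinarith)
      have := hf.monotone (Fin.le_def.mpr (Nat.zero_le _) : (⟨0, hj⟩ : Fin a) ≤ k)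
      rw [Fin.le_def] at this
      omega
    exact ⟨h, step 0 hj h⟩
  | succ j ih =>
    intro hj
    obtain ⟨h1, h2⟩ := ih (by omega)
    have h : (f ⟨j + 1, hj⟩ : ℕ) < (j + 1 + 1) * t := by
      have := h2 hj
      nlinarith
    exact ⟨h, step _ hj h⟩

lemma strictMono_fin_of_lt_succ {a : ℕ} {α : Type*} [Preorder α] {f : Fin a → α}
    (h : ∀ (j : ℕ) (hj : j + 1 < a), f ⟨j, by omega⟩ < f ⟨j + 1, hj⟩) : StrictMono f := by
  cases a with
  | zero => exact fun i ↦ i.elim0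
  | succ a => exact Fin.strictMono_iff_lt_succ.mpr fun i ↦ h i (by omega)

lemma strictMono_fin_bounds {a m : ℕ} {g : Fin a → Fin m} (hg : StrictMono g) (j : Fin a) :
    (j : ℕ) ≤ g j ∧ (g j : ℕ) + a ≤ m + j := by
  constructor
  · obtain ⟨j, hj⟩ := j
    induction j with
    | zero => exact Nat.zero_le _
    | succ j ih =>
      have := ih (by omega)
      have := Fin.lt_def.mp (hg (Fin.lt_def.mpr (Nat.lt_succ_self j) :
        (⟨j, by omega⟩ : Fin a) < ⟨j + 1, hj⟩))
      simp only at *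
      omega
  · have key (r : ℕ) : ∀ (j : ℕ) (hj : j < a), j + 1 + r = a → (g ⟨j, hj⟩ : ℕ) + a ≤ m + j := by
      induction r with
      | zero =>
        intro j hj h
        have := (g ⟨j, hj⟩).isLt
        omega
      | succ r ih =>
        intro j hj h
        have := ih (j + 1) (by omega) (by omega)
        have := Fin.lt_def.mp (hg (Fin.lt_def.mpr (Nat.lt_succ_self j) :
          (⟨j, hj⟩ : Fin a) < ⟨j + 1, by omega⟩))
        omega
    exact key (a - 1 - j) j j.isLt (by omega)

/-- A strictly monotone family is determined by its image. -/
lemma strictMono_eq_of_image_eq {a : ℕ} {α : Type*} [LinearOrder α] {f g : Fin a → α}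
    (hf : StrictMono f) (hg : StrictMono g)
    (h : Finset.univ.image f = Finset.univ.image g) : f = g := by
  refine (hf.range_inj hg).mp ?_
  simpa using congrArg (fun s : Finset α ↦ (s : Set α)) h

lemma card_pathCovers {n t a b : ℕ} (ha : 1 ≤ a) (hb : b < t) (hn : n = a * t + b) :
    (pathCovers n t a).card = (a + t - b - 1).choose a := by
  set m := a + t - b - 1 with hm
  have hat : (a - 1) * t + t = a * t := by
    rw [← Nat.succ_mul]; congr 1; omega
  have hjt (j : Fin a) : (j : ℕ) * t + t ≤ a * t := by
    rw [← Nat.succ_mul]; exact Nat.mul_le_mul_right t j.isLt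
  -- the position sent to the `j`-th element of a subset of `Fin m`, and conversely
  have hlt (g : Fin a → Fin m) (hg : StrictMono g) (j : Fin a) :
      (j : ℕ) * t + j + t - 1 - g j < n := by
    have := strictMono_fin_bounds hg j
    have := hjt j
    omega
  let F (g : Fin a → Fin m) (hg : StrictMono g) (j : Fin a) : Fin n := ⟨_, hlt g hg j⟩
  have hF (g : Fin a → Fin m) (hg : StrictMono g) (j : Fin a) :
      (F g hg j : ℕ) + g j + 1 = j * t + j + t := by
    have := strictMono_fin_bounds hg j
    simp only [F]
    omega
  have hFstep (g : Fin a → Fin m) (hg : StrictMono g) (j : ℕ) (hj : j + 1 < a) :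
      (F g hg ⟨j, by omega⟩ : ℕ) < F g hg ⟨j + 1, hj⟩ ∧
      (F g hg ⟨j + 1, hj⟩ : ℕ) ≤ F g hg ⟨j, by omega⟩ + t := by
    have h1 := hF g hg ⟨j, by omega⟩
    have h2 := hF g hg ⟨j + 1, hj⟩
    have h3 := strictMono_fin_bounds hg ⟨j, by omega⟩
    have h4 := strictMono_fin_bounds hg ⟨j + 1, hj⟩
    have h5 := Fin.lt_def.mp (hg (Fin.lt_def.mpr (Nat.lt_succ_self j) :
      (⟨j, by omega⟩ : Fin a) < ⟨j + 1, hj⟩))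
    simp only [Nat.succ_mul] at h1 h2 h3 h4
    omega
  have hFmono (g : Fin a → Fin m) (hg : StrictMono g) : StrictMono (F g hg) :=
    strictMono_fin_of_lt_succ fun j hj ↦ Fin.lt_def.mpr (hFstep g hg j hj).1
  have hcard : (a + t - b - 1).choose a =
      (Finset.powersetCard a (Finset.univ : Finset (Fin m))).card := by
    simp [hm]
  rw [hcard]
  symm
  refine Finset.card_bij (fun D hD ↦ Finset.univ.image
    (F (D.orderEmbOfFin (Finset.mem_powersetCard_univ.mp hD)) (OrderEmbedding.strictMono _))) ?_ ?_ ?_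
  · intro D hD
    set g := D.orderEmbOfFin (Finset.mem_powersetCard_univ.mp hD) with hgdef
    have hg : StrictMono g := OrderEmbedding.strictMono _
    rw [mem_pathCovers]
    refine ⟨by rw [Finset.card_image_of_injective _ (hFmono g hg).injective]; simp, ?_⟩
    intro i hi
    suffices h : ∃ j, i ≤ (F g hg j : ℕ) ∧ (F g hg j : ℕ) < i + t by
      obtain ⟨j, hj⟩ := h
      exact ⟨_, Finset.mem_image_of_mem _ (Finset.mem_univ j), hj⟩
    have hex : ∃ j, ∃ hj : j < a, i ≤ (F g hg ⟨j, hj⟩ : ℕ) := by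
      refine ⟨a - 1, by omega, ?_⟩
      have h1 := hF g hg ⟨a - 1, by omega⟩
      have h2 := strictMono_fin_bounds hg ⟨a - 1, by omega⟩
      simp only at h1 h2
      omega
    obtain ⟨j, ⟨hj, hij⟩, hmin⟩ : ∃ j, (∃ hj : j < a, i ≤ (F g hg ⟨j, hj⟩ : ℕ)) ∧
        ∀ k < j, ¬ ∃ hk : k < a, i ≤ (F g hg ⟨k, hk⟩ : ℕ) := by
      classical
      exact ⟨Nat.find hex, Nat.find_spec hex, fun k hk ↦ Nat.find_min hex hk⟩
    refine ⟨⟨j, hj⟩, hij, ?_⟩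
    rcases j with _ | j
    · have h1 := hF g hg ⟨0, hj⟩
      simp only at h1
      omega
    · have h1 : (F g hg ⟨j, by omega⟩ : ℕ) < i := by
        by_contra h
        exact hmin j j.lt_succ_self ⟨by omega, by omega⟩
      have h2 := (hFstep g hg j hj).2
      omega
  · intro D hD D' hD' h
    have hEq := strictMono_eq_of_image_eq
      (hFmono _ (OrderEmbedding.strictMono _)) (hFmono _ (OrderEmbedding.strictMono _)) h
    have hgg : (D.orderEmbOfFin (Finset.mem_powersetCard_univ.mp hD) : Fin a → Fin m) =
        D'.orderEmbOfFin (Finset.mem_powersetCard_univ.mp hD') := by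
      funext j
      have h1 := hF _ (OrderEmbedding.strictMono
        (D.orderEmbOfFin (Finset.mem_powersetCard_univ.mp hD))) j
      have h2 := hF _ (OrderEmbedding.strictMono
        (D'.orderEmbOfFin (Finset.mem_powersetCard_univ.mp hD'))) j
      rw [hEq] at h1
      apply Fin.ext
      omega
    have := congrArg Set.range hgg
    simpa using this
  · intro C hC
    obtain ⟨hCa, hCcov⟩ := mem_pathCovers.mp hC
    set f := C.orderEmbOfFin hCa with hfdef
    have hf : StrictMono f := OrderEmbedding.strictMono _
    have himg : Finset.univ.image f = C := by
      rw [← Finset.coe_inj]; simp [hfdef]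
    have hcov (i : ℕ) (hi : i + t ≤ n) : ∃ j, i ≤ (f j : ℕ) ∧ (f j : ℕ) < i + t := by
      obtain ⟨x, hx, hx'⟩ := hCcov i hi
      rw [← himg] at hx
      obtain ⟨j, -, rfl⟩ := Finset.mem_image.mp hx
      exact ⟨j, hx'⟩
    have hbd := strictMono_cover_bounds (by omega : a * t ≤ n) hf hcov
    have hlow (r : ℕ) : ∀ (j : ℕ) (hj : j < a), j + 1 + r = a → j * t + b ≤ (f ⟨j, hj⟩ : ℕ) := by
      induction r with
      | zero =>
        intro j hj h
        obtain ⟨k, hk, -⟩ := hcov ((a - 1) * t + b) (by omega)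
        have := Fin.le_def.mp (hf.monotone (Fin.le_def.mpr (by simp only; omega) :
          k ≤ ⟨j, hj⟩))
        obtain rfl : j = a - 1 := by omega
        omega
      | succ r ih =>
        intro j hj h
        have h1 := ih (j + 1) (by omega) (by omega)
        have h2 := (hbd j hj).2 (by omega)
        rw [Nat.succ_mul] at h1
        omega
    have hup (j : Fin a) : (f j : ℕ) < j * t + t := by
      have := (hbd j j.isLt).1
      rwa [Nat.succ_mul] at this
    have hlow' (j : Fin a) : (j : ℕ) * t + b ≤ f j :=
      hlow (a - 1 - j) j j.isLt (by omega)
    let g (j : Fin a) : Fin m := ⟨j * t + j + t - 1 - f j, by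
      have := hup j
      have := hlow' j
      omega⟩
    have hgf (j : Fin a) : (g j : ℕ) + f j + 1 = j * t + j + t := by
      have := hup j
      simp only [g]
      omega
    have hg : StrictMono g := by
      refine strictMono_fin_of_lt_succ fun j hj ↦ Fin.lt_def.mpr ?_
      have h1 := hgf ⟨j, by omega⟩
      have h2 := hgf ⟨j + 1, hj⟩
      have h3 := (hbd j (by omega)).2 hj
      simp only [Nat.succ_mul] at h1 h2
      omega
    have hD : (Finset.univ.image g).card = a := by
      rw [Finset.card_image_of_injective _ hg.injective]; simp
    refine ⟨Finset.univ.image g, Finset.mem_powersetCard_univ.mpr hD, ?_⟩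
    have hgD := Finset.orderEmbOfFin_unique hD
      (fun j ↦ Finset.mem_image_of_mem _ (Finset.mem_univ j)) hg
    rw [← himg]
    congr 1
    funext j
    have h1 := hF _ (OrderEmbedding.strictMono ((Finset.univ.image g).orderEmbOfFin hD)) j
    have h2 := hgf j
    have h3 := congrArg Fin.val (congrFun hgD j)
    apply Fin.ext
    omega

lemma dominatesPathPow_iff_min {n t s : ℕ} (d : Fin n → ℕ) :
    DominatesPathPow n t s d ↔ DominatesPathPow n t s fun i ↦ min (d i) s := by
  constructor
  · rintro ⟨m, hm, hm', h⟩
    exact ⟨m, hm, hm', fun j ↦ le_min (h j) (hm ▸ Multiset.countP_le_card _ _)⟩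
  · rintro ⟨m, hm, hm', h⟩
    exact ⟨m, hm, hm', fun j ↦ (h j).trans (min_le_left _ _)⟩

lemma exists_ne_of_not_dominatesPathPow {n t s : ℕ} {c : Fin n → ℕ}
    (hc : ¬ DominatesPathPow n t s c) (i : ℕ) (hi : i + t ≤ n) :
    ∃ j ∈ Finset.univ.filter (fun j ↦ c j ≠ s), i ≤ (j : ℕ) ∧ (j : ℕ) < i + t := by
  by_contra! h
  refine hc ⟨Multiset.replicate s i, by simp, fun k hk ↦ ?_, fun j ↦ ?_⟩
  · rwa [Multiset.eq_of_mem_replicate hk]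
  · by_cases hj : i ≤ (j : ℕ) ∧ (j : ℕ) < i + t
    · have hcj : c j = s := by
        by_contra hne
        have := h j (by simpa using hne) hj.1
        omega
      rw [hcj]
      exact (Multiset.countP_le_card _ _).trans (by simp)
    · rw [Multiset.countP_eq_zero.mpr]
      · exact Nat.zero_le _
      · intro k hk
        rwa [Multiset.eq_of_mem_replicate hk]

lemma le_card_of_cover {n t a : ℕ} (han : a * t ≤ n) {C : Finset (Fin n)}
    (hC : ∀ i, i + t ≤ n → ∃ j ∈ C, i ≤ (j : ℕ) ∧ (j : ℕ) < i + t) : a ≤ C.card := by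
  have hblock (k : Fin a) : ∃ j ∈ C, (k : ℕ) * t ≤ (j : ℕ) ∧ (j : ℕ) < k * t + t := by
    refine hC _ (le_trans ?_ han)
    rw [← Nat.succ_mul]
    exact Nat.mul_le_mul_right t k.isLt
  choose f hfC hf using hblock
  have hinj : Function.Injective f := by
    intro k l hkl
    have hdiv (k : Fin a) : (f k : ℕ) / t = k :=
      Nat.div_eq_of_lt_le (hf k).1 (by rw [Nat.succ_mul]; exact (hf k).2)
    exact Fin.ext (by rw [← hdiv k, ← hdiv l, hkl])
  calc a = (Finset.univ.image f).card := by
        rw [Finset.card_image_of_injective _ hinj, Finset.card_univ, Fintype.card_fin]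
    _ ≤ C.card := Finset.card_le_card fun x hx ↦ by
        obtain ⟨k, -, rfl⟩ := Finset.mem_image.mp hx
        exact hfC k

/-- Each vertex of a cover of minimal cardinality is the only one on some edge. -/
lemma exists_private_edge {n t a : ℕ} (han : a * t ≤ n) {C : Finset (Fin n)}
    (hC : C ∈ pathCovers n t a) {i : Fin n} (hi : i ∈ C) :
    ∃ w, w + t ≤ n ∧ ∀ j ∈ C, w ≤ (j : ℕ) ∧ (j : ℕ) < w + t → j = i := by
  by_contra! h
  have hle := le_card_of_cover han (C := C.erase i) fun w hw ↦ by
    obtain ⟨j, hj, hjw, hji⟩ := h w hw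
    exact ⟨j, Finset.mem_erase.mpr ⟨hji, hj⟩, hjw⟩
  rw [Finset.card_erase_of_mem hi] at hle
  have := Finset.card_pos.mpr ⟨i, hi⟩
  have := (mem_pathCovers.mp hC).1
  omega

lemma card_le_sum_countP_of_cover {n t : ℕ} {C : Finset (Fin n)}
    (hC : ∀ i, i + t ≤ n → ∃ j ∈ C, i ≤ (j : ℕ) ∧ (j : ℕ) < i + t) (m : Multiset ℕ)
    (hm : ∀ i ∈ m, i + t ≤ n) :
    m.card ≤ ∑ j ∈ C, m.countP (fun i ↦ i ≤ (j : ℕ) ∧ (j : ℕ) < i + t) := by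
  induction m using Multiset.induction_on with
  | empty => simp
  | cons i m ih =>
    simp only [Multiset.countP_cons, Finset.sum_add_distrib, Multiset.card_cons]
    refine Nat.add_le_add (ih fun k hk ↦ hm k (Multiset.mem_cons_of_mem hk)) ?_
    obtain ⟨j, hj, hij⟩ := hC i (hm i (Multiset.mem_cons_self i m))
    refine le_trans (le_of_eq (if_pos hij).symm) (Finset.single_le_sum
      (f := fun j : Fin n ↦ if i ≤ (j : ℕ) ∧ (j : ℕ) < i + t then 1 else 0)
      (fun _ _ ↦ Nat.zero_le _) hj)

/-- Localizing at the minimal prime of a minimum cover `C`, the power of the path ideal becomes the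
power of that prime. -/
lemma dominatesPathPow_iff_le_sum {n t a s : ℕ} (han : a * t ≤ n) {C : Finset (Fin n)}
    (hC : C ∈ pathCovers n t a) {c : Fin n → ℕ} (hc : ∀ i ∉ C, c i = s) :
    DominatesPathPow n t s c ↔ s ≤ ∑ i ∈ C, c i := by
  constructor
  · rintro ⟨m, rfl, hm, h⟩
    exact (card_le_sum_countP_of_cover (mem_pathCovers.mp hC).2 m hm).trans
      (Finset.sum_le_sum fun j _ ↦ h j)
  · intro hs
    have hex (i : Fin n) : ∃ w, i ∈ C → w + t ≤ n ∧
        ∀ j ∈ C, w ≤ (j : ℕ) ∧ (j : ℕ) < w + t → j = i := by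
      by_cases hi : i ∈ C
      · obtain ⟨w, hw⟩ := exists_private_edge han hC hi
        exact ⟨w, fun _ ↦ hw⟩
      · exact ⟨0, fun h ↦ absurd h hi⟩
    choose w hw using hex
    obtain ⟨m, hm⟩ : ∃ m, m ∈ (∑ i ∈ C, Multiset.replicate (c i) i).powersetCard s := by
      rw [← Multiset.card_pos_iff_exists_mem, Multiset.card_powersetCard]
      exact Nat.choose_pos (by simpa using hs)
    obtain ⟨hmle, hm⟩ := Multiset.mem_powersetCard.mp hm
    have hmC (i : Fin n) (hi : i ∈ m) : i ∈ C := by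
      obtain ⟨k, hk, hik⟩ := Multiset.mem_sum.mp (Multiset.mem_of_le hmle hi)
      rwa [Multiset.eq_of_mem_replicate hik]
    refine ⟨m.map w, by simpa using hm, ?_, fun j ↦ ?_⟩
    · intro i hi
      obtain ⟨k, hk, rfl⟩ := Multiset.mem_map.mp hi
      exact (hw k (hmC k hk)).1
    · by_cases hj : j ∈ C
      · calc (m.map w).countP (fun i ↦ i ≤ (j : ℕ) ∧ (j : ℕ) < i + t)
            ≤ m.countP (j = ·) := by
              rw [Multiset.countP_map, Multiset.countP_eq_card_filter]
              refine Multiset.card_le_card (Multiset.le_filter.mpr ⟨Multiset.filter_le _ _, ?_⟩)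
              intro i hi
              obtain ⟨him, hi⟩ := Multiset.mem_filter.mp hi
              exact (hw i (hmC i him)).2 j hj hi
          _ ≤ (∑ i ∈ C, Multiset.replicate (c i) i).count j := Multiset.count_le_of_le j hmle
          _ = c j := by
              simp [Multiset.count_sum', Multiset.count_replicate, hj]
      · rw [hc j hj, ← hm, ← Multiset.card_map w m]
        exact Multiset.countP_le_card _ _

/-- The number of vectors in `ℕ^C` with coordinate sum less than `s`. -/
lemma card_sum_lt {ι : Type*} [DecidableEq ι] (C : Finset ι) {s : ℕ} (hs : 1 ≤ s) :
    ((Finset.range s).biUnion fun k ↦ Finset.finsuppAntidiag C k).card =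
      (s + C.card - 1).choose (s - 1) := by
  rw [Finset.card_biUnion]
  · simp only [Finset.card_finsuppAntidiag_nat_eq_multichoose]
    obtain ⟨s, rfl⟩ := Nat.exists_eq_add_of_le' hs
    rw [Nat.sum_range_multichoose, Nat.choose_symm_of_eq_add (by omega : s + C.card = C.card + s)]
    congr 1
    omega
  · intro k _ l _ hkl
    refine Finset.disjoint_left.mpr fun d hk hl ↦ hkl ?_
    rw [← (Finset.mem_finsuppAntidiag.mp hk).1, (Finset.mem_finsuppAntidiag.mp hl).1]

lemma card_fiber_not_dominatesPathPow {n t a s : ℕ} (hs : 1 ≤ s) (han : a * t ≤ n)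
    {C : Finset (Fin n)} (hC : C ∈ pathCovers n t a) (T : Finset (Fin n → ℕ))
    (hT : ∀ c, c ∈ T ↔ (∀ i, c i ≤ s) ∧ ¬ DominatesPathPow n t s c ∧
      Finset.univ.filter (fun i ↦ c i ≠ s) = C) :
    T.card = (s + a - 1).choose (s - 1) := by
  rw [← (mem_pathCovers.mp hC).1, ← card_sum_lt C hs]
  have hoff {c : Fin n → ℕ} (hc : Finset.univ.filter (fun i ↦ c i ≠ s) = C) :
      ∀ i ∉ C, c i = s := fun i hi ↦ by
    by_contra h
    exact hi (hc ▸ by simpa using h)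
  refine Finset.card_bij'
    (fun c _ ↦ Finsupp.equivFunOnFinite.symm fun i ↦ if i ∈ C then c i else 0)
    (fun d _ i ↦ if i ∈ C then d i else s) ?_ ?_ ?_ ?_
  · intro c hc
    obtain ⟨-, hdom, hcC⟩ := (hT c).mp hc
    rw [dominatesPathPow_iff_le_sum han hC (hoff hcC), not_le] at hdom
    simp only [Finset.mem_biUnion, Finset.mem_range, Finset.mem_finsuppAntidiag]
    refine ⟨_, hdom, Finset.sum_congr rfl fun i hi ↦ by simp [hi], fun i hi ↦ ?_⟩
    by_contra h
    simp [h] at hi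
  · intro d hd
    simp only [Finset.mem_biUnion, Finset.mem_range, Finset.mem_finsuppAntidiag] at hd
    obtain ⟨k, hk, hsum, -⟩ := hd
    have hlt (i : Fin n) (hi : i ∈ C) : d i < s :=
      ((Finset.single_le_sum (fun _ _ ↦ Nat.zero_le _) hi).trans hsum.le).trans_lt hk
    refine (hT _).mpr ⟨fun i ↦ ?_, ?_, ?_⟩
    · split_ifs with hi
      exacts [(hlt i hi).le, le_rfl]
    · rw [dominatesPathPow_iff_le_sum han hC (fun i hi ↦ if_neg hi), not_le,
        Finset.sum_congr rfl fun i hi ↦ if_pos hi, hsum]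
      exact hk
    · ext i
      by_cases hi : i ∈ C
      · simp [hi, (hlt i hi).ne]
      · simp [hi]
  · intro c hc
    funext i
    obtain ⟨-, -, hcC⟩ := (hT c).mp hc
    by_cases hi : i ∈ C
    · simp [hi]
    · simp [hi, hoff hcC i hi]
  · intro d hd
    simp only [Finset.mem_biUnion, Finset.mem_range, Finset.mem_finsuppAntidiag] at hd
    obtain ⟨k, -, -, hsupp⟩ := hd
    ext i
    by_cases hi : i ∈ C
    · simp [hi]
    · have : d i = 0 := by
        by_contra h
        exact hi (hsupp (Finsupp.mem_support_iff.mpr h))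
      simp [hi, this]

lemma card_filter_ne_add {n s : ℕ} (c : Fin n → ℕ) :
    (Finset.univ.filter fun i ↦ c i = s).card + (Finset.univ.filter fun i ↦ c i ≠ s).card = n := by
  rw [Finset.card_filter_add_card_filter_not, Finset.card_univ, Fintype.card_fin]

/-- Main theorem: if `n = a t + b` with `a ≥ 1`, `0 ≤ b < t`, then for every `s ≥ 1` the
multiplicity of `S/I_t(L_n)^s` equals `(s + a - 1).choose (s - 1) * (a + t - b - 1).choose a`:
the Hilbert function of `S/I_t(L_n)^s` eventually agrees with a polynomial of degree
`n - a - 1` whose leading coefficient is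
`(s + a - 1).choose (s - 1) * (a + t - b - 1).choose a / (n - a - 1)!`.  In particular, the
multiplicity of `S/I_t(L_n)^s` is a polynomial in `s` of degree `a` from the beginning. -/
theorem multiplicity_pathIdeal_pow (K : Type*) [Field K] (n t a b : ℕ)
    (ht : 2 ≤ t) (htn : t ≤ n) (ha : 1 ≤ a) (hb : b < t) (hn : n = a * t + b)
    (s : ℕ) (hs : 1 ≤ s) :
    ∃ P : Polynomial ℚ, P.degree = (n - a - 1 : ℕ) ∧
      P.leadingCoeff =
        ((s + a - 1).choose (s - 1) * (a + t - b - 1).choose a : ℚ) / (n - a - 1).factorial ∧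
      ∃ N : ℕ, ∀ k ≥ N,
        (hilbertFn K n (pathIdeal K n t ^ s) k : ℚ) = P.eval (k : ℚ) := by
  classical
  have han : a * t ≤ n := by omega
  have hat : a * 2 ≤ a * t := Nat.mul_le_mul_left a ht
  have hcover {c : Fin n → ℕ} (hc : ¬ DominatesPathPow n t s c) :
      a ≤ (Finset.univ.filter fun i ↦ c i ≠ s).card :=
    le_card_of_cover han (exists_ne_of_not_dominatesPathPow hc)
  have hpos : (s + a - 1).choose (s - 1) * (a + t - b - 1).choose a ≠ 0 :=
    (Nat.mul_pos (Nat.choose_pos (by omega)) (Nat.choose_pos (by omega))).ne'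
  have hcount : ((Fintype.piFinset fun _ : Fin n ↦ Finset.range (s + 1)).filter fun c ↦
      ¬ DominatesPathPow n t s c ∧
        (Finset.univ.filter fun i ↦ c i = s).card = n - a - 1 + 1).card =
      (s + a - 1).choose (s - 1) * (a + t - b - 1).choose a := by
    rw [Finset.card_eq_sum_card_fiberwise (f := fun c ↦ Finset.univ.filter fun i ↦ c i ≠ s)
      (t := pathCovers n t a)]
    · rw [Finset.sum_const_nat (m := (s + a - 1).choose (s - 1)), card_pathCovers ha hb hn,
        mul_comm]
      intro C hC
      refine card_fiber_not_dominatesPathPow hs han hC _ fun c ↦ ?_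
      have hcard : Finset.univ.filter (fun i ↦ c i ≠ s) = C →
          (Finset.univ.filter fun i ↦ c i = s).card = n - a - 1 + 1 := by
        intro h
        have h1 := card_filter_ne_add (s := s) c
        rw [h, (mem_pathCovers.mp hC).1] at h1
        omega
      simp only [Finset.mem_filter, Fintype.mem_piFinset, Finset.mem_range, Nat.lt_succ_iff]
      tauto
    · intro c hc
      rw [Finset.mem_coe, Finset.mem_filter] at hc
      refine mem_pathCovers.mpr ⟨?_, exists_ne_of_not_dominatesPathPow hc.2.1⟩
      have h1 := card_filter_ne_add (s := s) c
      have h2 := hc.2.2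
      change (Finset.univ.filter fun i ↦ c i ≠ s).card = a
      omega
  obtain ⟨P, hdeg, hlead, N, hN⟩ := exists_polynomial_card_filter
    (fun c : Fin n → ℕ ↦ ¬ DominatesPathPow n t s c) s (n - a - 1)
    ((s + a - 1).choose (s - 1) * (a + t - b - 1).choose a)
    (fun d ↦ not_congr (dominatesPathPow_iff_min d))
    (fun c hc ↦ by have := hcover hc; have := card_filter_ne_add (s := s) c; omega)
    (by convert hcount) hpos
  refine ⟨P, hdeg, by rw [hlead, Nat.cast_mul], N, fun k hk ↦ ?_⟩
  rw [hilbertFn_eq_card K n _ (fun d ↦ DominatesPathPow n t s d) (mem_pathIdeal_pow K n t s) k]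
  convert hN k hk
end

section
/- Let K be a field, 2 ≤ t ≤ n, and S = K[x_1,…,x_n]. Then the Rees algebra R(I_t(L_n)) = ⊕_{s ≥ 0} I_t(L_n)^s z^s ⊆ S[z] of the t-path ideal is a normal domain, i.e. it is an integral domain that is integrally closed in its field of fractions. -/
open MvPolynomial

/-- The least total weight of a finite set of integers meeting each of the intervals
`[i, i + t)` with `i < m`. -/
noncomputable def minHittingWeight (t : ℕ) (a : ℕ → ℕ) (m : ℕ) : ℕ :=
  sInf {w | ∃ C : Finset ℕ, (∀ i < m, ∃ j ∈ C, i ≤ j ∧ j < i + t) ∧ ∑ j ∈ C, a j = w}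

theorem exists_hitting_set_sum_eq {t : ℕ} (ht : 0 < t) (a : ℕ → ℕ) (m : ℕ) :
    ∃ C : Finset ℕ, (∀ i < m, ∃ j ∈ C, i ≤ j ∧ j < i + t) ∧
      ∑ j ∈ C, a j = minHittingWeight t a m := by
  have hne : {w | ∃ C : Finset ℕ, (∀ i < m, ∃ j ∈ C, i ≤ j ∧ j < i + t) ∧
      ∑ j ∈ C, a j = w}.Nonempty :=
    ⟨_, Finset.range m, fun i hi => ⟨i, by simpa using hi, le_rfl, by omega⟩, rfl⟩
  exact Nat.sInf_mem hne

theorem minHittingWeight_le {t m : ℕ} (a : ℕ → ℕ) {C : Finset ℕ}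
    (hC : ∀ i < m, ∃ j ∈ C, i ≤ j ∧ j < i + t) :
    minHittingWeight t a m ≤ ∑ j ∈ C, a j :=
  Nat.sInf_le ⟨C, hC, rfl⟩

theorem minHittingWeight_zero (t : ℕ) (a : ℕ → ℕ) : minHittingWeight t a 0 = 0 := by
  have h := minHittingWeight_le (t := t) (m := 0) a (C := ∅) (by simp)
  simpa using h

theorem minHittingWeight_mono {t : ℕ} (ht : 0 < t) (a : ℕ → ℕ) :
    Monotone (minHittingWeight t a) := by
  intro m m' hm
  obtain ⟨C, hC, hw⟩ := exists_hitting_set_sum_eq ht a m'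
  rw [← hw]
  exact minHittingWeight_le a fun i hi => hC i (hi.trans_le hm)

theorem minHittingWeight_succ_le {t : ℕ} (ht : 0 < t) (a : ℕ → ℕ) (j : ℕ) :
    minHittingWeight t a (j + 1) ≤ a j + minHittingWeight t a (j + 1 - t) := by
  classical
  obtain ⟨C, hC, hw⟩ := exists_hitting_set_sum_eq ht a (j + 1 - t)
  rw [← hw]
  refine (minHittingWeight_le a (C := insert j C) fun i hi => ?_).trans ?_
  · by_cases h : i < j + 1 - t
    · obtain ⟨k, hk, hk'⟩ := hC i h
      exact ⟨k, Finset.mem_insert_of_mem hk, hk'⟩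
    · exact ⟨j, Finset.mem_insert_self _ _, by omega, by omega⟩
  · by_cases hj : j ∈ C
    · rw [Finset.insert_eq_of_mem hj]
      exact Nat.le_add_left _ _
    · rw [Finset.sum_insert hj]

/-- Packing and covering duality for intervals of a fixed length. -/
theorem exists_interval_packing {t : ℕ} (ht : 0 < t) (a : ℕ → ℕ) (N : ℕ) :
    ∃ y : ℕ → ℕ, ∑ i ∈ Finset.range N, y i = minHittingWeight t a N ∧
      ∀ j, ∑ i ∈ (Finset.range N).filter (fun i => i ≤ j ∧ j < i + t), y i ≤ a j := by
  have hmono := minHittingWeight_mono ht a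
  refine ⟨fun i => minHittingWeight t a (i + 1) - minHittingWeight t a i, ?_, fun j => ?_⟩
  · rw [Finset.sum_range_tsub hmono, minHittingWeight_zero, Nat.sub_zero]
  · have hsub : (Finset.range N).filter (fun i => i ≤ j ∧ j < i + t) ⊆
        Finset.Ico (j + 1 - t) (j + 1) := by
      intro i hi
      simp only [Finset.mem_filter, Finset.mem_range, Finset.mem_Ico] at hi ⊢
      omega
    refine (Finset.sum_le_sum_of_subset hsub).trans ?_
    have hsum : ∑ i ∈ Finset.Ico (j + 1 - t) (j + 1),
        (minHittingWeight t a (i + 1) - minHittingWeight t a i) =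
        minHittingWeight t a (j + 1) - minHittingWeight t a (j + 1 - t) := by
      rw [Finset.sum_Ico_eq_sum_range, ← Nat.add_sub_of_le (show j + 1 - t ≤ j + 1 by omega)]
      have h := Finset.sum_range_tsub (f := fun k => minHittingWeight t a (j + 1 - t + k))
        (fun x y hxy => hmono (by omega)) (j + 1 - (j + 1 - t))
      simpa [add_assoc] using h
    rw [hsum]
    have := minHittingWeight_succ_le ht a j
    omega

/-- Multiply each variable with index in `C` by a new variable, recording the `C`-degree. -/
noncomputable def gradeBy (K : Type*) [Field K] {n : ℕ} (C : Finset ℕ) :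
    MvPolynomial (Fin n) K →ₐ[K] Polynomial (MvPolynomial (Fin n) K) :=
  aeval fun j => Polynomial.C (X j) * Polynomial.X ^ (if (j : ℕ) ∈ C then 1 else 0)

section

variable {K : Type*} [Field K] {n : ℕ}

theorem gradeBy_monomial (C : Finset ℕ) (a : Fin n →₀ ℕ) (c : K) :
    gradeBy K C (monomial a c) =
      Polynomial.monomial (∑ j : Fin n, if (j : ℕ) ∈ C then a j else 0) (monomial a c) := by
  rw [gradeBy, aeval_monomial, Finsupp.prod_fintype _ _ (by simp)]
  simp only [mul_pow, Finset.prod_mul_distrib, ← pow_mul, Finset.prod_pow_eq_pow_sum]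
  rw [← Polynomial.C_mul_X_pow_eq_monomial, monomial_eq, Finsupp.prod_fintype _ _ (by simp)]
  rw [map_mul, map_prod, mul_assoc]
  simp only [map_pow, ite_mul, one_mul, zero_mul]
  rfl

theorem coeff_coeff_gradeBy (C : Finset ℕ) (f : MvPolynomial (Fin n) K) (a : Fin n →₀ ℕ) :
    ((gradeBy K C f).coeff (∑ j : Fin n, if (j : ℕ) ∈ C then a j else 0)).coeff a = f.coeff a := by
  induction f using MvPolynomial.induction_on' with
  | monomial b c =>
    rw [gradeBy_monomial, Polynomial.coeff_monomial]
    by_cases h : b = a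
    · subst h; simp
    · split_ifs <;> simp [coeff_monomial, h]
  | add p q hp hq => simp [hp, hq]

/-- `C` meets the support of every generator of the path ideal. -/
def HitsPaths (n t : ℕ) (C : Finset ℕ) : Prop :=
  ∀ i, i + t ≤ n → ∃ j ∈ C, i ≤ j ∧ j < i + t

theorem X_pow_dvd_gradeBy {t : ℕ} {C : Finset ℕ} (hC : HitsPaths n t C) {s : ℕ}
    {f : MvPolynomial (Fin n) K} (hf : f ∈ pathIdeal K n t ^ s) :
    Polynomial.X ^ s ∣ gradeBy K C f := by
  have hle : (pathIdeal K n t).map (gradeBy K C) ≤ Ideal.span {Polynomial.X} := by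
    rw [pathIdeal, Ideal.map_span, Ideal.span_le]
    rintro _ ⟨_, ⟨i, hi, rfl⟩, rfl⟩
    obtain ⟨j, hj, hij, hjt⟩ := hC i hi
    have hi' : i + t ≤ n := hi
    rw [SetLike.mem_coe, Ideal.mem_span_singleton, pathGen, map_prod]
    refine dvd_trans ?_ (Finset.dvd_prod_of_mem _
      (a := (⟨j, by omega⟩ : Fin n)) (by simp [hij, hjt]))
    simp [gradeBy, hj]
  have h := Ideal.pow_right_mono hle s (by
    rw [← Ideal.map_pow]; exact Ideal.mem_map_of_mem _ hf)
  rwa [Ideal.span_singleton_pow, Ideal.mem_span_singleton] at h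

theorem monomial_mem_pathIdeal_pow {t : ℕ} (ht : 0 < t) (htn : t ≤ n) {s : ℕ} {a : Fin n →₀ ℕ}
    (ha : ∀ C, HitsPaths n t C → s ≤ ∑ j : Fin n, if (j : ℕ) ∈ C then a j else 0) (c : K) :
    monomial a c ∈ pathIdeal K n t ^ s := by
  classical
  set a' : ℕ → ℕ := fun j => if h : j < n then a ⟨j, h⟩ else 0 with ha'
  obtain ⟨y, hy, hya⟩ := exists_interval_packing ht a' (n - t + 1)
  obtain ⟨C, hC, hw⟩ := exists_hitting_set_sum_eq ht a' (n - t + 1)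
  have hs : s ≤ ∑ i ∈ Finset.range (n - t + 1), y i := by
    rw [hy, ← hw]
    refine (ha C fun i hi => hC i (by omega)).trans ?_
    rw [← Finset.sum_filter,
      ← Finset.sum_map _ ⟨Fin.val, Fin.val_injective⟩ a' |>.trans (Finset.sum_congr rfl
        fun j _ => by simp [ha'])]
    refine Finset.sum_le_sum_of_subset fun j hj => ?_
    simp only [Finset.mem_map, Finset.mem_filter, Finset.mem_univ, true_and,
      Function.Embedding.coeFn_mk] at hj
    obtain ⟨k, hk, rfl⟩ := hj
    exact hk
  have hmem : ∏ i ∈ Finset.range (n - t + 1), pathGen K n t i ^ y i ∈ pathIdeal K n t ^ s := by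
    refine Ideal.pow_le_pow_right hs ?_
    rw [← Finset.prod_pow_eq_pow_sum]
    refine Ideal.prod_mem_prod fun i hi => Ideal.pow_mem_pow ?_ _
    rw [Finset.mem_range] at hi
    exact Ideal.subset_span ⟨i, show i + t ≤ n by omega, rfl⟩
  refine Ideal.mem_of_dvd _ ?_ hmem
  rw [monomial_eq, Finsupp.prod_fintype _ _ (by simp)]
  refine Dvd.dvd.mul_left ?_ _
  simp only [pathGen, ← Finset.prod_pow]
  rw [Finset.prod_comm' (t' := Finset.univ) (s' := fun j : Fin n =>
    (Finset.range (n - t + 1)).filter (fun i => i ≤ (j : ℕ) ∧ (j : ℕ) < i + t)) (by simp)]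
  refine Finset.prod_dvd_prod_of_dvd _ _ fun j _ => ?_
  rw [Finset.prod_pow_eq_pow_sum]
  refine pow_dvd_pow _ ((hya j).trans ?_)
  simp [ha']

theorem mem_pathIdeal_pow_iff {t : ℕ} (ht : 0 < t) (htn : t ≤ n) {s : ℕ}
    {f : MvPolynomial (Fin n) K} :
    f ∈ pathIdeal K n t ^ s ↔ ∀ C, HitsPaths n t C → Polynomial.X ^ s ∣ gradeBy K C f := by
  refine ⟨fun hf C hC => X_pow_dvd_gradeBy hC hf, fun h => ?_⟩
  rw [f.as_sum]
  refine Ideal.sum_mem _ fun a ha => monomial_mem_pathIdeal_pow ht htn (fun C hC => ?_) _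
  by_contra! hlt
  refine mem_support_iff.mp ha ?_
  rw [← coeff_coeff_gradeBy C, Polynomial.X_pow_dvd_iff.mp (h C hC) _ hlt, coeff_zero]

end

theorem IsIntegral.of_forall_mem_range {A B D E : Type*} [CommRing A] [CommRing B] [CommRing D]
    [CommRing E] [Algebra A B] [Algebra D E] (g : B →+* E)
    (hD : Function.Injective (algebraMap D E))
    (hg : ∀ x : A, g (algebraMap A B x) ∈ (algebraMap D E).range) {b : B} (hb : IsIntegral A b) :
    IsIntegral D (g b) := by
  let e := RingEquiv.ofBijective (algebraMap D E).rangeRestrict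
    ⟨fun x y h => hD (congrArg Subtype.val h), RingHom.rangeRestrict_surjective _⟩
  let φ : A →+* D := e.symm.toRingHom.comp ((g.comp (algebraMap A B)).codRestrict _ hg)
  refine hb.map_of_comp_eq φ g (RingHom.ext fun x => ?_)
  exact congrArg Subtype.val (e.apply_symm_apply ⟨g (algebraMap A B x), hg x⟩)

section

variable {K : Type*} [Field K] {n : ℕ}

/-- The substitution sending the Rees variable `z` to `z / w` and each `x_j`, `j ∈ C`,
to `x_j w`. -/
noncomputable def gradeReesBy (K : Type*) [Field K] {n : ℕ} (C : Finset ℕ) :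
    Polynomial (MvPolynomial (Fin n) K) →+*
      Polynomial (FractionRing (Polynomial (MvPolynomial (Fin n) K))) :=
  (Polynomial.compRingHom (Polynomial.C (algebraMap (Polynomial (MvPolynomial (Fin n) K)) _
      Polynomial.X)⁻¹ * Polynomial.X)).comp
    (Polynomial.mapRingHom ((algebraMap (Polynomial (MvPolynomial (Fin n) K)) _).comp
      (gradeBy K C).toRingHom))

theorem coeff_gradeReesBy (C : Finset ℕ) (f : Polynomial (MvPolynomial (Fin n) K)) (i : ℕ) :
    (gradeReesBy K C f).coeff i =
      algebraMap _ (FractionRing (Polynomial (MvPolynomial (Fin n) K)))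
        (gradeBy K C (f.coeff i)) /
          algebraMap (Polynomial (MvPolynomial (Fin n) K)) _ Polynomial.X ^ i := by
  simp [gradeReesBy, div_eq_mul_inv, -map_inv₀]

theorem coeff_gradeReesBy_mem_range_iff (C : Finset ℕ)
    (f : Polynomial (MvPolynomial (Fin n) K)) (i : ℕ) :
    (gradeReesBy K C f).coeff i ∈ (algebraMap (Polynomial (MvPolynomial (Fin n) K))
        (FractionRing (Polynomial (MvPolynomial (Fin n) K)))).range ↔
      Polynomial.X ^ i ∣ gradeBy K C (f.coeff i) := by
  have hinj := IsFractionRing.injective (Polynomial (MvPolynomial (Fin n) K))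
    (FractionRing (Polynomial (MvPolynomial (Fin n) K)))
  have hX : algebraMap (Polynomial (MvPolynomial (Fin n) K))
      (FractionRing (Polynomial (MvPolynomial (Fin n) K))) Polynomial.X ^ i ≠ 0 :=
    pow_ne_zero _ ((map_ne_zero_iff _ hinj).mpr Polynomial.X_ne_zero)
  rw [coeff_gradeReesBy]
  constructor
  · rintro ⟨q, hq⟩
    refine ⟨q, hinj ?_⟩
    rw [map_mul, map_pow, hq, mul_div_cancel₀ _ hX]
  · rintro ⟨q, hq⟩
    refine ⟨q, ?_⟩
    rw [hq, map_mul, map_pow, mul_div_cancel_left₀ _ hX]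

attribute [local instance] Polynomial.algebra in
theorem mem_reesAlgebra_pathIdeal_of_isIntegral {t : ℕ} (ht : 0 < t) (htn : t ≤ n)
    {f : Polynomial (MvPolynomial (Fin n) K)}
    (hf : IsIntegral (reesAlgebra (pathIdeal K n t)) f) : f ∈ reesAlgebra (pathIdeal K n t) := by
  intro i
  rw [mem_pathIdeal_pow_iff ht htn]
  intro C hC
  rw [← coeff_gradeReesBy_mem_range_iff]
  have hint : IsIntegral (Polynomial (Polynomial (MvPolynomial (Fin n) K)))
      (gradeReesBy K C f) := by
    refine hf.of_forall_mem_range _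
      (Polynomial.map_injective _ (IsFractionRing.injective _ _)) fun x => ?_
    exact (Polynomial.mem_map_rangeS _).mpr fun k =>
      (coeff_gradeReesBy_mem_range_iff C _ k).mpr (X_pow_dvd_gradeBy hC (x.2 k))
  exact IsIntegrallyClosed.isIntegral_iff.mp (hint.coeff i)

end

/-- The Rees algebra `R(I_t(L_n)) = ⊕_{s ≥ 0} I_t(L_n)^s z^s ⊆ S[z]` of the `t`-path ideal
is a normal domain: an integral domain which is integrally closed in its fraction field. -/
theorem reesAlgebra_pathIdeal_normal_domain (K : Type*) [Field K] (n t : ℕ)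
    (ht : 2 ≤ t) (htn : t ≤ n) :
    IsDomain (reesAlgebra (pathIdeal K n t)) ∧
      IsIntegrallyClosed (reesAlgebra (pathIdeal K n t)) := by
  refine ⟨inferInstance, ?_⟩
  have : IsIntegrallyClosedIn (reesAlgebra (pathIdeal K n t))
      (Polynomial (MvPolynomial (Fin n) K)) :=
    isIntegrallyClosedIn_iff.mpr ⟨Subtype.val_injective, fun {f} hf =>
      ⟨⟨f, mem_reesAlgebra_pathIdeal_of_isIntegral (by omega) htn hf⟩, rfl⟩⟩
  exact .of_isIntegrallyClosed_of_isIntegrallyClosedIn _ (Polynomial (MvPolynomial (Fin n) K))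
end
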